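/- arXiv:math/0211074 — 11 statements merged into one kernel-verified Lean document; each statement's English description precedes it below -/
import Mathlib

section
/- Let A be an ε-bialgebra over a commutative ring k. Define a k-bilinear operation on A by a ∘ b := b₁·a·b₂, where Δ(b) = b₁ ⊗ b₂. Then (A, ∘) is a left pre-Lie algebra, i.e. a ∘ (b ∘ c) − (a ∘ b) ∘ c = b ∘ (a ∘ c) − (b ∘ a) ∘ c for all a, b, c ∈ A. -/
open TensorProduct

/-- The map `A ⊗ A →ₗ A`, `x ⊗ y ↦ x * a * y`. -/
noncomputable def sandwich (k : Type*) {A : Type*} [CommRing k] [NonUnitalRing A]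
    [Module k A] [SMulCommClass k A A] [IsScalarTower k A A] (a : A) :
    A ⊗[k] A →ₗ[k] A :=
  TensorProduct.lift (LinearMap.mk₂ k (fun x y => x * a * y)
    (fun x x' y => by simp [add_mul])
    (fun c x y => by simp [smul_mul_assoc])
    (fun x y y' => by simp [mul_add])
    (fun c x y => by simp [mul_smul_comm]))

section Sandwich

variable {k A : Type*} [CommRing k] [NonUnitalRing A]
    [Module k A] [SMulCommClass k A A] [IsScalarTower k A A]

@[simp]
theorem sandwich_tmul (a x y : A) : sandwich k a (x ⊗ₜ[k] y) = x * a * y := rfl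

theorem sandwich_map_mulLeft (a x : A) (t : A ⊗[k] A) :
    sandwich k a (TensorProduct.map (LinearMap.mulLeft k x) LinearMap.id t) =
      x * sandwich k a t := by
  induction t with
  | zero => simp
  | tmul u v => simp [mul_assoc]
  | add s t hs ht => simp only [map_add, hs, ht, mul_add]

theorem sandwich_map_mulRight (a y : A) (t : A ⊗[k] A) :
    sandwich k a (TensorProduct.map LinearMap.id (LinearMap.mulRight k y) t) =
      sandwich k a t * y := by
  induction t with
  | zero => simp
  | tmul u v => simp [mul_assoc]
  | add s t hs ht => simp only [map_add, hs, ht, add_mul]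

/-- The map `A ⊗ (A ⊗ A) →ₗ A`, `x ⊗ (y ⊗ z) ↦ x * a * (y * b * z)`. -/
noncomputable def doubleSandwich (k : Type*) {A : Type*} [CommRing k] [NonUnitalRing A]
    [Module k A] [SMulCommClass k A A] [IsScalarTower k A A] (a b : A) :
    A ⊗[k] (A ⊗[k] A) →ₗ[k] A :=
  sandwich k a ∘ₗ TensorProduct.map LinearMap.id (sandwich k b)

@[simp]
theorem doubleSandwich_tmul (a b x : A) (t : A ⊗[k] A) :
    doubleSandwich k a b (x ⊗ₜ[k] t) = x * a * sandwich k b t := rfl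

theorem doubleSandwich_assoc_tmul (a b y : A) (t : A ⊗[k] A) :
    doubleSandwich k a b (TensorProduct.assoc k A A A (t ⊗ₜ[k] y)) =
      sandwich k a t * b * y := by
  induction t with
  | zero => simp
  | tmul u v => simp [mul_assoc]
  | add s t hs ht => simp only [TensorProduct.add_tmul, map_add, hs, ht, add_mul]

/-- Expansion of `a ∘ (c₁ * b * c₂)` when `Δ` is a derivation. -/
theorem sandwich_comul_sandwich (Δ : A →ₗ[k] A ⊗[k] A)
    (hder : ∀ a b : A,
      Δ (a * b) = (TensorProduct.map (LinearMap.mulLeft k a) LinearMap.id) (Δ b)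
        + (TensorProduct.map LinearMap.id (LinearMap.mulRight k b)) (Δ a))
    (a b : A) (t : A ⊗[k] A) :
    sandwich k a (Δ (sandwich k b t)) =
      doubleSandwich k b a (TensorProduct.map LinearMap.id Δ t)
        + sandwich k (sandwich k a (Δ b)) t
        + doubleSandwich k a b
          (TensorProduct.assoc k A A A (TensorProduct.map Δ LinearMap.id t)) := by
  induction t with
  | zero => simp
  | tmul x y =>
    simp only [sandwich_tmul, hder, map_add, sandwich_map_mulLeft, sandwich_map_mulRight,
      TensorProduct.map_tmul, LinearMap.id_apply, doubleSandwich_tmul,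
      doubleSandwich_assoc_tmul, add_assoc]
  | add s t hs ht =>
    simp only [map_add, hs, ht]
    abel

end Sandwich

/-- Any ε-bialgebra `(A, μ, Δ)` becomes a left pre-Lie algebra under
`a ∘ b := b₁·a·b₂`. -/
theorem epsilon_bialgebra_preLie {k A : Type*} [CommRing k] [NonUnitalRing A]
    [Module k A] [SMulCommClass k A A] [IsScalarTower k A A]
    (Δ : A →ₗ[k] A ⊗[k] A)
    (hcoassoc : ∀ a : A,
      (TensorProduct.assoc k A A A) ((TensorProduct.map Δ LinearMap.id) (Δ a)) =
        (TensorProduct.map LinearMap.id Δ) (Δ a))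
    (hder : ∀ a b : A,
      Δ (a * b) = (TensorProduct.map (LinearMap.mulLeft k a) LinearMap.id) (Δ b)
        + (TensorProduct.map LinearMap.id (LinearMap.mulRight k b)) (Δ a))
    (circ : A → A → A)
    (hcirc : ∀ a b : A, circ a b = sandwich k a (Δ b)) :
    ∀ a b c : A,
      circ a (circ b c) - circ (circ a b) c = circ b (circ a c) - circ (circ b a) c := by
  intro a b c
  simp only [hcirc, sandwich_comul_sandwich Δ hder, hcoassoc]
  abel
end

section
/- Let A be an ε-bialgebra over a commutative ring k and let B : A → A be a k-linear biderivation, i.e. B(a·b) = a·B(b) + B(a)·b for all a, b ∈ A, and Δ(B(a)) = a₁ ⊗ B(a₂) + B(a₁) ⊗ a₂ for all a ∈ A. Then B is a derivation of the associated pre-Lie operation a ∘ b := b₁·a·b₂, that is, B(a ∘ b) = a ∘ B(b) + B(a) ∘ b for all a, b ∈ A. -/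
open TensorProduct

/-- A biderivation `B` of an ε-bialgebra `A` is a derivation of the associated
pre-Lie algebra `a ∘ b = b₁·a·b₂`. -/
theorem biderivation_preLie_derivation {k A : Type*} [CommRing k]
    [NonUnitalRing A] [Module k A] [SMulCommClass k A A] [IsScalarTower k A A]
    (Δ : A →ₗ[k] A ⊗[k] A)
    (hcoassoc : ∀ a : A,
      (TensorProduct.assoc k A A A) ((TensorProduct.map Δ LinearMap.id) (Δ a)) =
        (TensorProduct.map LinearMap.id Δ) (Δ a))
    (hder : ∀ a b : A,
      Δ (a * b) = (TensorProduct.map (LinearMap.mulLeft k a) LinearMap.id) (Δ b)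
        + (TensorProduct.map LinearMap.id (LinearMap.mulRight k b)) (Δ a))
    (B : A →ₗ[k] A)
    (hBder : ∀ a b : A, B (a * b) = a * B b + B a * b)
    (hBcoder : ∀ a : A,
      Δ (B a) = (TensorProduct.map LinearMap.id B) (Δ a)
        + (TensorProduct.map B LinearMap.id) (Δ a))
    (circ : A → A → A)
    (hcirc : ∀ a b : A, circ a b = sandwich k a (Δ b)) :
    ∀ a b : A, B (circ a b) = circ a (B b) + circ (B a) b := by
  intro a b
  simp only [hcirc, hBcoder]
  generalize Δ b = t
  induction t with
  | zero => simp
  | add x y hx hy =>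
    simp only [map_add] at hx hy ⊢
    rw [hx, hy]
    abel
  | tmul x y =>
    simp only [sandwich, map_add, TensorProduct.map_tmul, LinearMap.id_apply,
      TensorProduct.lift.tmul, LinearMap.mk₂_apply, hBder, add_mul]
    abel
end

section
/- Let A be a (possibly non-unital) associative k-algebra and let r = Σᵢ uᵢ ⊗ vᵢ ∈ A ⊗ A be a solution of the associative Yang–Baxter equation. Then the k-linear map β : A → A defined by β(x) = Σᵢ uᵢ·x·vᵢ is a Baxter operator: β(x)·β(y) = β(x·β(y) + β(x)·y) for all x, y ∈ A. -/
open TensorProduct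

/-- If `r = Σᵢ uᵢ ⊗ vᵢ` is a solution of the associative Yang–Baxter equation in an
associative algebra `A`, then `β(x) = Σᵢ uᵢ·x·vᵢ` is a Baxter operator. -/
theorem aybe_gives_baxter {k A ι : Type*} [CommRing k] [NonUnitalRing A]
    [Module k A] [SMulCommClass k A A] [IsScalarTower k A A]
    [Fintype ι] (u v : ι → A)
    (hAYBE : (∑ i, ∑ j, (u i * u j) ⊗ₜ[k] ((v j) ⊗ₜ[k] (v i)))
        - (∑ i, ∑ j, (u i) ⊗ₜ[k] ((v i * u j) ⊗ₜ[k] (v j)))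
        + (∑ i, ∑ j, (u j) ⊗ₜ[k] ((u i) ⊗ₜ[k] (v i * v j)))
        = (0 : A ⊗[k] (A ⊗[k] A)))
    (β : A → A) (hβ : ∀ x : A, β x = ∑ i, u i * x * v i) :
    ∀ x y : A, β x * β y = β (x * β y + β x * y) := by
  intro x y
  let φ : A ⊗[k] (A ⊗[k] A) →ₗ[k] A :=
    LinearMap.mul' k A ∘ₗ TensorProduct.map (LinearMap.mulRight k x)
      (LinearMap.mul' k A ∘ₗ TensorProduct.map (LinearMap.mulRight k y) LinearMap.id)
  have hφ (a b c : A) : φ (a ⊗ₜ[k] (b ⊗ₜ[k] c)) = a * x * (b * y * c) := by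
    simp [φ]
  have h := congrArg φ hAYBE
  simp only [map_add, map_sub, map_sum, hφ, map_zero] at h
  have hxy : β x * β y = ∑ i, ∑ j, u i * x * (v i * u j * y * v j) := by
    simp only [hβ, Finset.sum_mul_sum, mul_assoc]
  have hadd : β (x * β y + β x * y) = β (x * β y) + β (β x * y) := by
    simp only [hβ (_ + _), hβ (x * _), hβ (_ * y), mul_add, add_mul, Finset.sum_add_distrib]
  have hleft : β (β x * y) = ∑ i, ∑ j, u i * u j * x * (v j * y * v i) := by
    simp only [hβ, Finset.sum_mul, Finset.mul_sum, mul_assoc]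
  have hright : β (x * β y) = ∑ i, ∑ j, u j * x * (u i * y * (v i * v j)) := by
    rw [Finset.sum_comm]
    simp only [hβ, Finset.sum_mul, Finset.mul_sum, mul_assoc]
  rw [hxy, hadd, hleft, hright, ← sub_eq_zero, ← neg_eq_zero, ← h]
  abel
end

section
/- Let A be a (possibly non-unital) associative k-algebra and let r = Σᵢ uᵢ ⊗ vᵢ ∈ A ⊗ A be a solution of the associative Yang–Baxter equation. Define operations on A by x ≻ y := Σᵢ uᵢ·x·vᵢ·y and x ≺ y := Σᵢ x·uᵢ·y·vᵢ. Then (A, ≻, ≺) is a dendriform algebra. -/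
open TensorProduct

/-- For a solution `r = Σᵢ uᵢ ⊗ vᵢ` of the associative Yang–Baxter equation, the map
`x ↦ Σᵢ uᵢ·x·vᵢ` is a Rota–Baxter operator of weight zero. -/
theorem rotaBaxter_of_aybe {k A ι : Type*} [CommRing k] [NonUnitalRing A]
    [Module k A] [SMulCommClass k A A] [IsScalarTower k A A]
    [Fintype ι] (u v : ι → A)
    (hAYBE : (∑ i, ∑ j, (u i * u j) ⊗ₜ[k] ((v j) ⊗ₜ[k] (v i)))
        - (∑ i, ∑ j, (u i) ⊗ₜ[k] ((v i * u j) ⊗ₜ[k] (v j)))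
        + (∑ i, ∑ j, (u j) ⊗ₜ[k] ((u i) ⊗ₜ[k] (v i * v j)))
        = (0 : A ⊗[k] (A ⊗[k] A))) (x y : A) :
    (∑ i, u i * x * v i) * (∑ i, u i * y * v i) =
      (∑ i, u i * (x * ∑ j, u j * y * v j) * v i) +
        ∑ i, u i * ((∑ j, u j * x * v j) * y) * v i := by
  have h := congrArg (LinearMap.mul' k A ∘ₗ TensorProduct.map (LinearMap.mulRight k x)
    (LinearMap.mul' k A ∘ₗ TensorProduct.map (LinearMap.mulRight k y) LinearMap.id)) hAYBE
  simp only [map_add, map_sub, map_sum, map_zero, LinearMap.comp_apply, TensorProduct.map_tmul,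
    LinearMap.mulRight_apply, LinearMap.mul'_apply, LinearMap.id_apply] at h
  rw [Finset.sum_comm (f := fun i j => u j * x * (u i * y * (v i * v j)))] at h
  simp only [Finset.sum_mul_sum]
  simp only [Finset.mul_sum, Finset.sum_mul, mul_assoc] at h ⊢
  rw [sub_add_eq_add_sub, sub_eq_zero] at h
  rw [← h, add_comm]

/-- A solution `r = Σᵢ uᵢ ⊗ vᵢ` of the associative Yang–Baxter equation in an
associative algebra `A` yields a dendriform structure on `A` via
`x ≻ y := Σᵢ uᵢ·x·vᵢ·y` and `x ≺ y := Σᵢ x·uᵢ·y·vᵢ`. -/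
theorem aybe_gives_dendriform {k A ι : Type*} [CommRing k] [NonUnitalRing A]
    [Module k A] [SMulCommClass k A A] [IsScalarTower k A A]
    [Fintype ι] (u v : ι → A)
    (hAYBE : (∑ i, ∑ j, (u i * u j) ⊗ₜ[k] ((v j) ⊗ₜ[k] (v i)))
        - (∑ i, ∑ j, (u i) ⊗ₜ[k] ((v i * u j) ⊗ₜ[k] (v j)))
        + (∑ i, ∑ j, (u j) ⊗ₜ[k] ((u i) ⊗ₜ[k] (v i * v j)))
        = (0 : A ⊗[k] (A ⊗[k] A)))
    (succ prec : A → A → A)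
    (hsucc : ∀ x y : A, succ x y = ∑ i, u i * x * v i * y)
    (hprec : ∀ x y : A, prec x y = ∑ i, x * u i * y * v i) :
    (∀ x y z : A, prec (prec x y) z = prec x (prec y z) + prec x (succ y z))
    ∧ (∀ x y z : A, succ x (prec y z) = prec (succ x y) z)
    ∧ (∀ x y z : A, succ x (succ y z) = succ (prec x y) z + succ (succ x y) z) := by
  have hs (x y : A) : succ x y = (∑ i, u i * x * v i) * y := by
    rw [hsucc, Finset.sum_mul]
  have hp (x y : A) : prec x y = x * ∑ i, u i * y * v i := by
    simp only [hprec, Finset.mul_sum, mul_assoc]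
  have rb := rotaBaxter_of_aybe u v hAYBE
  refine ⟨fun x y z => ?_, fun x y z => ?_, fun x y z => ?_⟩
  · simp only [hs, hp]
    rw [mul_assoc, rb, mul_add]
  · simp only [hs, hp, mul_assoc]
  · simp only [hs, hp]
    rw [← mul_assoc, rb, add_mul]
end

section
/- Let A be a (possibly non-unital) associative k-algebra, r = Σᵢ uᵢ ⊗ vᵢ ∈ A ⊗ A a solution of the associative Yang–Baxter equation, and Δ(a) = Σᵢ uᵢ ⊗ vᵢ·a − Σᵢ a·uᵢ ⊗ vᵢ the principal comultiplication. Let M be a left A-module. Then the k-linear map Λ : M → A ⊗ M, Λ(m) = Σᵢ uᵢ ⊗ vᵢ·m, makes M a left ε-Hopf module over A: Λ is coassociative, (Δ ⊗ id)Λ = (id ⊗ Λ)Λ, and Λ(a·m) = a·m₋₁ ⊗ m₀ + a₁ ⊗ a₂·m for all a ∈ A, m ∈ M (writing Λ(m) = m₋₁ ⊗ m₀ and Δ(a) = a₁ ⊗ a₂). -/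
open TensorProduct

/-- For a quasitriangular ε-bialgebra `(A, r)` with principal comultiplication
`Δ(a) = r·a − a·r`, any left `A`-module `M` becomes a left ε-Hopf module via the
coaction `Λ(m) = Σᵢ uᵢ ⊗ vᵢ·m`. -/
theorem module_over_quasitriangular_is_hopf_module {k A M ι : Type*} [CommRing k]
    [NonUnitalRing A] [Module k A] [SMulCommClass k A A] [IsScalarTower k A A]
    [AddCommGroup M] [Module k M] [Fintype ι] (u v : ι → A)
    (hAYBE : (∑ i, ∑ j, (u i * u j) ⊗ₜ[k] ((v j) ⊗ₜ[k] (v i)))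
        - (∑ i, ∑ j, (u i) ⊗ₜ[k] ((v i * u j) ⊗ₜ[k] (v j)))
        + (∑ i, ∑ j, (u j) ⊗ₜ[k] ((u i) ⊗ₜ[k] (v i * v j)))
        = (0 : A ⊗[k] (A ⊗[k] A)))
    (Δ : A →ₗ[k] A ⊗[k] A)
    (hΔ : ∀ a : A,
      Δ a = (∑ i, (u i) ⊗ₜ[k] (v i * a)) - ∑ i, (a * u i) ⊗ₜ[k] (v i))
    (μM : A →ₗ[k] M →ₗ[k] M)
    (hμM : ∀ (a b : A) (m : M), μM (a * b) m = μM a (μM b m))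
    (Λ : M →ₗ[k] A ⊗[k] M)
    (hΛ : ∀ m : M, Λ m = ∑ i, (u i) ⊗ₜ[k] (μM (v i) m)) :
    (∀ m : M,
      (TensorProduct.assoc k A A M) ((TensorProduct.map Δ LinearMap.id) (Λ m)) =
        (TensorProduct.map LinearMap.id Λ) (Λ m))
    ∧ (∀ (a : A) (m : M),
      Λ (μM a m) = (TensorProduct.map (LinearMap.mulLeft k a) LinearMap.id) (Λ m)
        + (TensorProduct.map LinearMap.id (μM.flip m)) (Δ a)) := by
  constructor
  · intro m
    have h := congrArg
      (TensorProduct.map LinearMap.id (TensorProduct.map LinearMap.id (μM.flip m))) hAYBE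
    simp only [map_add, map_sub, map_sum, map_zero, TensorProduct.map_tmul, LinearMap.id_apply,
      LinearMap.flip_apply, hμM] at h
    simp only [hΛ, hΔ, map_sum, map_sub, TensorProduct.map_tmul, LinearMap.id_apply,
      TensorProduct.sub_tmul, TensorProduct.sum_tmul, TensorProduct.tmul_sum,
      TensorProduct.assoc_tmul, Finset.sum_sub_distrib]
    rw [Finset.sum_comm (f := fun j i => u i ⊗ₜ[k] ((v i * u j) ⊗ₜ[k] μM (v j) m)),
      Finset.sum_comm (f := fun j i => u j ⊗ₜ[k] (u i ⊗ₜ[k] μM (v i) (μM (v j) m))),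
      eq_comm, ← sub_eq_zero, ← h]
    abel
  · intro a m
    simp only [hΛ, hΔ, map_sum, map_sub, TensorProduct.map_tmul, LinearMap.id_apply,
      LinearMap.flip_apply, LinearMap.mulLeft_apply, hμM]
    abel
end

section
/- Let A be a (possibly non-unital) associative k-algebra, r = Σᵢ uᵢ ⊗ vᵢ ∈ A ⊗ A a solution of the associative Yang–Baxter equation, Δ(a) = Σᵢ uᵢ ⊗ vᵢ·a − Σᵢ a·uᵢ ⊗ vᵢ the principal comultiplication, and M an A-bimodule. Define Λ : M → A ⊗ M, Λ(m) = Σᵢ uᵢ ⊗ vᵢ·m, and Ξ : M → M ⊗ A, Ξ(m) = −Σᵢ m·uᵢ ⊗ vᵢ. Then M is an ε-Hopf bimodule over A: (a) Λ is coassociative and Λ(a·m) = a·m₋₁ ⊗ m₀ + a₁ ⊗ a₂·m; (b) Ξ is coassociative ((Ξ ⊗ id)Ξ = (id ⊗ Δ)Ξ) and Ξ(m·a) = m₀ ⊗ m₁·a + m·a₁ ⊗ a₂; (c) M is an A-bimodule; (d) (id ⊗ Ξ)Λ = (Λ ⊗ id)Ξ; (e) Ξ(a·m) = a·m₀ ⊗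 m₁ and Λ(m·a) = m₋₁ ⊗ m₀·a, where Λ(m) = m₋₁ ⊗ m₀, Ξ(m) = m₀ ⊗ m₁ and Δ(a) = a₁ ⊗ a₂. -/
open TensorProduct

/-- For a quasitriangular ε-bialgebra `(A, r)` with principal comultiplication
`Δ(a) = r·a − a·r`, any `A`-bimodule `M` becomes an ε-Hopf bimodule via
`Λ(m) = Σᵢ uᵢ ⊗ vᵢ·m` and `Ξ(m) = −Σᵢ m·uᵢ ⊗ vᵢ`.  Here the left action is
`μL a m = a·m` and the right action is `ν m a = m·a`. -/
theorem bimodule_over_quasitriangular_is_hopf_bimodule {k A M ι : Type*} [CommRing k]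
    [NonUnitalRing A] [Module k A] [SMulCommClass k A A] [IsScalarTower k A A]
    [AddCommGroup M] [Module k M] [Fintype ι] (u v : ι → A)
    (hAYBE : (∑ i, ∑ j, (u i * u j) ⊗ₜ[k] ((v j) ⊗ₜ[k] (v i)))
        - (∑ i, ∑ j, (u i) ⊗ₜ[k] ((v i * u j) ⊗ₜ[k] (v j)))
        + (∑ i, ∑ j, (u j) ⊗ₜ[k] ((u i) ⊗ₜ[k] (v i * v j)))
        = (0 : A ⊗[k] (A ⊗[k] A)))
    (Δ : A →ₗ[k] A ⊗[k] A)
    (hΔ : ∀ a : A,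
      Δ a = (∑ i, (u i) ⊗ₜ[k] (v i * a)) - ∑ i, (a * u i) ⊗ₜ[k] (v i))
    (μL : A →ₗ[k] M →ₗ[k] M)
    (hμL : ∀ (a b : A) (m : M), μL (a * b) m = μL a (μL b m))
    (ν : M →ₗ[k] A →ₗ[k] M)
    (hν : ∀ (m : M) (a b : A), ν (ν m a) b = ν m (a * b))
    (hbimod : ∀ (a : A) (m : M) (b : A), ν (μL a m) b = μL a (ν m b))
    (Λ : M →ₗ[k] A ⊗[k] M)
    (hΛ : ∀ m : M, Λ m = ∑ i, (u i) ⊗ₜ[k] (μL (v i) m))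
    (Ξ : M →ₗ[k] M ⊗[k] A)
    (hΞ : ∀ m : M, Ξ m = -∑ i, (ν m (u i)) ⊗ₜ[k] (v i)) :
    -- (a) M is a left ε-Hopf module
    (∀ m : M,
      (TensorProduct.assoc k A A M) ((TensorProduct.map Δ LinearMap.id) (Λ m)) =
        (TensorProduct.map LinearMap.id Λ) (Λ m))
    ∧ (∀ (a : A) (m : M),
      Λ (μL a m) = (TensorProduct.map (LinearMap.mulLeft k a) LinearMap.id) (Λ m)
        + (TensorProduct.map LinearMap.id (μL.flip m)) (Δ a))
    -- (b) M is a right ε-Hopf module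
    ∧ (∀ m : M,
      (TensorProduct.assoc k M A A) ((TensorProduct.map Ξ LinearMap.id) (Ξ m)) =
        (TensorProduct.map LinearMap.id Δ) (Ξ m))
    ∧ (∀ (m : M) (a : A),
      Ξ (ν m a) = (TensorProduct.map LinearMap.id (LinearMap.mulRight k a)) (Ξ m)
        + (TensorProduct.map (ν m) LinearMap.id) (Δ a))
    -- (c) M is an A-bimodule
    ∧ (∀ (a : A) (m : M) (b : A), ν (μL a m) b = μL a (ν m b))
    -- (d) M is a bicomodule
    ∧ (∀ m : M,
      (TensorProduct.map LinearMap.id Ξ) (Λ m) =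
        (TensorProduct.assoc k A M A) ((TensorProduct.map Λ LinearMap.id) (Ξ m)))
    -- (e) the mixed compatibilities
    ∧ (∀ (a : A) (m : M),
      Ξ (μL a m) = (TensorProduct.map (μL a) LinearMap.id) (Ξ m))
    ∧ (∀ (m : M) (a : A),
      Λ (ν m a) = (TensorProduct.map LinearMap.id (ν.flip a)) (Λ m)) := by
  refine ⟨fun m => ?_, fun a m => ?_, fun m => ?_, fun m a => ?_, hbimod, fun m => ?_,
    fun a m => ?_, fun m a => ?_⟩
  · have h := congrArg
      (TensorProduct.map LinearMap.id (TensorProduct.map LinearMap.id (μL.flip m))) hAYBE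
    simp only [map_add, map_sub, map_sum, map_zero, TensorProduct.map_tmul, LinearMap.id_apply,
      LinearMap.flip_apply, hμL] at h
    simp only [hΛ, hΔ, map_sum, map_sub, TensorProduct.map_tmul, LinearMap.id_apply,
      TensorProduct.sub_tmul, TensorProduct.sum_tmul, TensorProduct.tmul_sum,
      TensorProduct.assoc_tmul, Finset.sum_sub_distrib]
    rw [Finset.sum_comm, ← sub_eq_zero, ← neg_eq_zero, ← h,
      Finset.sum_comm (f := fun i j => u j ⊗ₜ[k] (u i ⊗ₜ[k] μL (v i) (μL (v j) m)))]
    abel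
  · simp only [hΛ, hΔ, map_sum, map_sub, TensorProduct.map_tmul, LinearMap.id_apply,
      LinearMap.flip_apply, LinearMap.mulLeft_apply, hμL]
    abel
  · have h := congrArg (TensorProduct.map (ν m) LinearMap.id) hAYBE
    simp only [map_add, map_sub, map_sum, map_zero, TensorProduct.map_tmul,
      LinearMap.id_apply] at h
    simp only [hΞ, hΔ, map_sum, map_neg, TensorProduct.map_tmul, LinearMap.id_apply,
      TensorProduct.neg_tmul, TensorProduct.sum_tmul, TensorProduct.tmul_sub,
      TensorProduct.tmul_sum, TensorProduct.assoc_tmul, Finset.sum_sub_distrib,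
      Finset.sum_neg_distrib, neg_neg, hν]
    rw [← sub_eq_zero, ← h,
      Finset.sum_comm (f := fun i j => ν m (u j) ⊗ₜ[k] (u i ⊗ₜ[k] (v i * v j)))]
    abel
  · simp only [hΞ, hΔ, map_sum, map_sub, map_neg, TensorProduct.map_tmul, LinearMap.id_apply,
      LinearMap.mulRight_apply, hν]
    abel
  · simp only [hΛ, hΞ, map_sum, map_neg, TensorProduct.map_tmul, LinearMap.id_apply,
      TensorProduct.sum_tmul, TensorProduct.tmul_neg, TensorProduct.tmul_sum,
      TensorProduct.assoc_tmul, Finset.sum_neg_distrib, hbimod]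
    rw [Finset.sum_comm]
  · simp only [hΞ, map_sum, map_neg, TensorProduct.map_tmul, LinearMap.id_apply, hbimod]
  · simp only [hΛ, map_sum, TensorProduct.map_tmul, LinearMap.id_apply, LinearMap.flip_apply,
      hbimod]
end

section
/- Let A be a (possibly non-unital) associative k-algebra, r = Σᵢ uᵢ ⊗ vᵢ ∈ A ⊗ A a solution of the associative Yang–Baxter equation, and M an A-bimodule. Then the k-linear map β_M : M → M, β_M(m) = Σᵢ uᵢ·m·vᵢ, is a Baxter operator on M relative to the Baxter operator β_A(x) = Σᵢ uᵢ·x·vᵢ on A: β_A(a)·β_M(m) = β_M(a·β_M(m) + β_A(a)·m) and β_M(m)·β_A(a) = β_M(m·β_A(a) + β_M(m)·a) for all a ∈ A, m ∈ M. -/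
open TensorProduct

/-- Evaluating the associative Yang–Baxter equation along `x ⊗ y ⊗ z ↦ L x (G y z)`. -/
theorem sum_eq_of_aybe {k A M ι : Type*} [CommRing k]
    [NonUnitalRing A] [Module k A] [AddCommGroup M] [Module k M] [Fintype ι] {u v : ι → A}
    (h : (∑ i, ∑ j, (u i * u j) ⊗ₜ[k] ((v j) ⊗ₜ[k] (v i)))
        - (∑ i, ∑ j, (u i) ⊗ₜ[k] ((v i * u j) ⊗ₜ[k] (v j)))
        + (∑ i, ∑ j, (u j) ⊗ₜ[k] ((u i) ⊗ₜ[k] (v i * v j)))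
        = (0 : A ⊗[k] (A ⊗[k] A)))
    (L : A →ₗ[k] M →ₗ[k] M) (G : A →ₗ[k] A →ₗ[k] M) :
    ∑ i, ∑ j, L (u i) (G (v i * u j) (v j)) =
      ∑ i, ∑ j, L (u j) (G (u i) (v i * v j)) + ∑ i, ∑ j, L (u i * u j) (G (v j) (v i)) := by
  have key := congrArg
    (TensorProduct.lift (LinearMap.lcomp k M (TensorProduct.lift G) ∘ₗ L)) h
  simp only [map_add, map_sub, map_sum, map_zero, TensorProduct.lift.tmul,
    LinearMap.comp_apply, LinearMap.lcomp_apply] at key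
  rw [sub_add_eq_add_sub, sub_eq_zero] at key
  rw [← key, add_comm]

/-- For a solution `r = Σᵢ uᵢ ⊗ vᵢ` of the associative Yang–Baxter equation in `A`
and an `A`-bimodule `M`, the map `β_M(m) = Σᵢ uᵢ·m·vᵢ` is a Baxter operator on `M`
relative to the Baxter operator `β_A(x) = Σᵢ uᵢ·x·vᵢ` on `A`. -/
theorem aybe_gives_baxter_on_bimodule {k A M ι : Type*} [CommRing k]
    [NonUnitalRing A] [Module k A] [SMulCommClass k A A] [IsScalarTower k A A]
    [AddCommGroup M] [Module k M] [Fintype ι] (u v : ι → A)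
    (hAYBE : (∑ i, ∑ j, (u i * u j) ⊗ₜ[k] ((v j) ⊗ₜ[k] (v i)))
        - (∑ i, ∑ j, (u i) ⊗ₜ[k] ((v i * u j) ⊗ₜ[k] (v j)))
        + (∑ i, ∑ j, (u j) ⊗ₜ[k] ((u i) ⊗ₜ[k] (v i * v j)))
        = (0 : A ⊗[k] (A ⊗[k] A)))
    (μL : A →ₗ[k] M →ₗ[k] M)
    (hμL : ∀ (a b : A) (m : M), μL (a * b) m = μL a (μL b m))
    (ν : M →ₗ[k] A →ₗ[k] M)
    (hν : ∀ (m : M) (a b : A), ν (ν m a) b = ν m (a * b))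
    (hbimod : ∀ (a : A) (m : M) (b : A), ν (μL a m) b = μL a (ν m b))
    (βA : A → A) (hβA : ∀ x : A, βA x = ∑ i, u i * x * v i)
    (βM : M → M) (hβM : ∀ m : M, βM m = ∑ i, ν (μL (u i) m) (v i)) :
    (∀ (a : A) (m : M), μL (βA a) (βM m) = βM (μL a (βM m) + μL (βA a) m))
    ∧ (∀ (m : M) (a : A), ν (βM m) (βA a) = βM (ν m (βA a) + ν (βM m) a)) := by
  constructor
  · intro a m
    have key := sum_eq_of_aybe hAYBE (LinearMap.lcomp k M (μL a) ∘ₗ μL) (ν ∘ₗ μL.flip m)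
    simp only [LinearMap.comp_apply, LinearMap.lcomp_apply, LinearMap.flip_apply, hμL, hbimod,
      ← hν] at key
    simp only [hβA, hβM, map_add, map_sum, LinearMap.sum_apply, LinearMap.add_apply, hμL, hbimod,
      Finset.sum_add_distrib]
    rw [Finset.sum_comm, key, Finset.sum_comm]
  · intro m a
    have key := sum_eq_of_aybe hAYBE μL (ν ∘ₗ ν.flip a ∘ₗ ν m)
    simp only [LinearMap.comp_apply, LinearMap.flip_apply, hμL, ← hν] at key
    simp only [hβA, hβM, map_add, map_sum, LinearMap.sum_apply, LinearMap.add_apply, hbimod, ← hν,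
      Finset.sum_add_distrib]
    rw [Finset.sum_comm, key, Finset.sum_comm]
end

section
/- Let A be a (possibly non-unital) associative k-algebra, β_A : A → A a Baxter operator, M an A-bimodule, and β_M : M → M a Baxter operator on M relative to β_A. Define x ≻ y := β_A(x)·y and x ≺ y := x·β_A(y) on A, and define a ≻ m := β_A(a)·m, m ≻ a := β_M(m)·a, a ≺ m := a·β_M(m), m ≺ a := m·β_A(a). Then M is a dendriform bimodule over the dendriform algebra (A, ≻, ≺): all nine dendriform bimodule identities hold, namely the three dendriform identities (x ≺ y) ≺ z = x ≺ (y ≺ z) + x ≺ (y ≻ z), x ≻ (y ≺ z) = (x ≻ y) ≺ z, x ≻ (y ≻ z) = (x ≺ y) ≻ z + (x ≻ y) ≻ z, where one of x, y, z is taken in M and the other two in A (in each of the three possible positions). -/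
/-- Let `β_A` be a Baxter operator on an associative algebra `A`, `M` an
`A`-bimodule (left action `μL a m = a·m`, right action `ν m a = m·a`), and `β_M` a
Baxter operator on `M` relative to `β_A`.  Then `M` is a dendriform bimodule over
the dendriform algebra `(A, ≻, ≺)` with `x ≻ y = β_A(x)·y`, `x ≺ y = x·β_A(y)`, via
`a ≻ m = β_A(a)·m`, `m ≻ a = β_M(m)·a`, `a ≺ m = a·β_M(m)`, `m ≺ a = m·β_A(a)`. -/
theorem baxter_bimodule_gives_dendriform_bimodule {k A M : Type*} [CommRing k]
    [NonUnitalRing A] [Module k A] [SMulCommClass k A A] [IsScalarTower k A A]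
    [AddCommGroup M] [Module k M]
    (μL : A →ₗ[k] M →ₗ[k] M)
    (hμL : ∀ (a b : A) (m : M), μL (a * b) m = μL a (μL b m))
    (ν : M →ₗ[k] A →ₗ[k] M)
    (hν : ∀ (m : M) (a b : A), ν (ν m a) b = ν m (a * b))
    (hbimod : ∀ (a : A) (m : M) (b : A), ν (μL a m) b = μL a (ν m b))
    (βA : A →ₗ[k] A)
    (hβA : ∀ x y : A, βA x * βA y = βA (x * βA y + βA x * y))
    (βM : M →ₗ[k] M)
    (hβM₁ : ∀ (a : A) (m : M), μL (βA a) (βM m) = βM (μL a (βM m) + μL (βA a) m))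
    (hβM₂ : ∀ (m : M) (a : A), ν (βM m) (βA a) = βM (ν m (βA a) + ν (βM m) a))
    -- dendriform operations on A
    (sA pA : A → A → A)
    (hsA : ∀ x y : A, sA x y = βA x * y) (hpA : ∀ x y : A, pA x y = x * βA y)
    -- mixed dendriform operations
    (sAM pAM : A → M → M) (sMA pMA : M → A → M)
    (hsAM : ∀ (a : A) (m : M), sAM a m = μL (βA a) m)
    (hpAM : ∀ (a : A) (m : M), pAM a m = μL a (βM m))
    (hsMA : ∀ (m : M) (a : A), sMA m a = ν (βM m) a)
    (hpMA : ∀ (m : M) (a : A), pMA m a = ν m (βA a)) :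
    -- first dendriform identity, with m in each of the three positions
    (∀ (m : M) (y z : A), pMA (pMA m y) z = pMA m (pA y z) + pMA m (sA y z))
    ∧ (∀ (x : A) (m : M) (z : A), pMA (pAM x m) z = pAM x (pMA m z) + pAM x (sMA m z))
    ∧ (∀ (x y : A) (m : M), pAM (pA x y) m = pAM x (pAM y m) + pAM x (sAM y m))
    -- second dendriform identity, with m in each of the three positions
    ∧ (∀ (m : M) (y z : A), sMA m (pA y z) = pMA (sMA m y) z)
    ∧ (∀ (x : A) (m : M) (z : A), sAM x (pMA m z) = pMA (sAM x m) z)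
    ∧ (∀ (x y : A) (m : M), sAM x (pAM y m) = pAM (sA x y) m)
    -- third dendriform identity, with m in each of the three positions
    ∧ (∀ (m : M) (y z : A), sMA m (sA y z) = sMA (pMA m y) z + sMA (sMA m y) z)
    ∧ (∀ (x : A) (m : M) (z : A),
        sAM x (sMA m z) = sMA (pAM x m) z + sMA (sAM x m) z)
    ∧ (∀ (x y : A) (m : M), sAM x (sAM y m) = sAM (pA x y) m + sAM (sA x y) m) := by
  simp only [hsA, hpA, hsAM, hpAM, hsMA, hpMA]
  refine ⟨fun m y z => ?_, fun x m z => ?_, fun x y m => ?_, fun m y z => ?_,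
    fun x m z => ?_, fun x y m => ?_, fun m y z => ?_, fun x m z => ?_, fun x y m => ?_⟩
  · rw [hν, hβA, map_add, map_add]
  · rw [hbimod, hβM₂, map_add, map_add]
  · rw [hμL, hβM₁, map_add, map_add]
  · rw [hν]
  · rw [hbimod]
  · rw [hμL]
  · rw [← hν, hβM₂, map_add, map_add, LinearMap.add_apply]
  · rw [← hbimod, hβM₁, map_add, map_add, LinearMap.add_apply]
  · rw [← hμL, hβA, map_add, map_add, LinearMap.add_apply]
end

section
/- Let A be a counital ε-bialgebra over a commutative ring k with counit η : A → k. Then η(a·b) = 0 for all a, b ∈ A. -/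
open TensorProduct

/-- Evaluating two functionals on a tensor does not depend on the order of evaluation. -/
theorem apply_rid_map_eq_apply_lid_map {k M N : Type*} [CommSemiring k] [AddCommMonoid M]
    [AddCommMonoid N] [Module k M] [Module k N] (f : M →ₗ[k] k) (g : N →ₗ[k] k) (t : M ⊗[k] N) :
    f (TensorProduct.rid k M (TensorProduct.map LinearMap.id g t)) =
      g (TensorProduct.lid k N (TensorProduct.map f LinearMap.id t)) := by
  induction t with
  | zero => simp
  | tmul x y => simp [mul_comm]
  | add x y hx hy => simp only [map_add, hx, hy]

/-- Contracting the right factor commutes with a linear map on the left factor. -/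
theorem rid_map_map_left {k M N P : Type*} [CommSemiring k] [AddCommMonoid M]
    [AddCommMonoid N] [AddCommMonoid P] [Module k M] [Module k N] [Module k P]
    (f : M →ₗ[k] P) (g : N →ₗ[k] k) (t : M ⊗[k] N) :
    TensorProduct.rid k P (TensorProduct.map LinearMap.id g (TensorProduct.map f LinearMap.id t)) =
      f (TensorProduct.rid k M (TensorProduct.map LinearMap.id g t)) := by
  induction t with
  | zero => simp
  | tmul x y => simp
  | add x y hx hy => simp only [map_add, hx, hy]

/-- The counit `η` of a counital ε-bialgebra vanishes on products: `η(a·b) = 0`. -/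
theorem counit_vanishes_on_products {k A : Type*} [CommRing k] [NonUnitalRing A]
    [Module k A] [SMulCommClass k A A] [IsScalarTower k A A]
    (Δ : A →ₗ[k] A ⊗[k] A)
    (hcoassoc : ∀ a : A,
      (TensorProduct.assoc k A A A) ((TensorProduct.map Δ LinearMap.id) (Δ a)) =
        (TensorProduct.map LinearMap.id Δ) (Δ a))
    (hder : ∀ a b : A,
      Δ (a * b) = (TensorProduct.map (LinearMap.mulLeft k a) LinearMap.id) (Δ b)
        + (TensorProduct.map LinearMap.id (LinearMap.mulRight k b)) (Δ a))
    (η : A →ₗ[k] k)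
    (hcounit₁ : ∀ a : A,
      (TensorProduct.rid k A) ((TensorProduct.map LinearMap.id η) (Δ a)) = a)
    (hcounit₂ : ∀ a : A,
      (TensorProduct.lid k A) ((TensorProduct.map η LinearMap.id) (Δ a)) = a) :
    ∀ a b : A, η (a * b) = 0 := by
  intro a b
  have h := hcounit₁ (a * b)
  rw [hder, map_add, map_add, rid_map_map_left, hcounit₁, LinearMap.mulLeft_apply,
    add_eq_left, TensorProduct.map_map, LinearMap.id_comp] at h
  have h' := apply_rid_map_eq_apply_lid_map η (η ∘ₗ LinearMap.mulRight k b) (Δ a)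
  rw [h, hcounit₂, map_zero] at h'
  exact h'.symm
end

section
/- Let (A, η_A) and (B, η_B) be augmented algebras over a commutative ring k. Then the k-bilinear multiplication on A ⊗ B defined by (a ⊗ b)·(a' ⊗ b') := η_B(b)·(aa' ⊗ b') + η_A(a')·(a ⊗ bb') is associative, and A ⊗ B is augmented by η(a ⊗ b) := η_A(a)η_B(b), i.e. η vanishes on all products in A ⊗ B. -/
open TensorProduct

/-- For augmented algebras `(A, η_A)` and `(B, η_B)`, the multiplication
`(a ⊗ b)·(a' ⊗ b') = η_B(b)·(aa' ⊗ b') + η_A(a')·(a ⊗ bb')` on `A ⊗ B` is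
associative, and `A ⊗ B` is augmented by `η(a ⊗ b) = η_A(a)η_B(b)`. -/
theorem augmented_tensor_product {k A B : Type*} [CommRing k]
    [NonUnitalRing A] [Module k A] [SMulCommClass k A A] [IsScalarTower k A A]
    [NonUnitalRing B] [Module k B] [SMulCommClass k B B] [IsScalarTower k B B]
    (ηA : A →ₗ[k] k) (hηA : ∀ a a' : A, ηA (a * a') = 0)
    (ηB : B →ₗ[k] k) (hηB : ∀ b b' : B, ηB (b * b') = 0)
    (mul : A ⊗[k] B →ₗ[k] A ⊗[k] B →ₗ[k] A ⊗[k] B)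
    (hmul : ∀ (a a' : A) (b b' : B),
      mul (a ⊗ₜ[k] b) (a' ⊗ₜ[k] b')
        = ηB b • ((a * a') ⊗ₜ[k] b') + ηA a' • (a ⊗ₜ[k] (b * b'))) :
    (∀ x y z : A ⊗[k] B, mul (mul x y) z = mul x (mul y z))
    ∧ (∀ x y : A ⊗[k] B,
        (TensorProduct.lid k k) ((TensorProduct.map ηA ηB) (mul x y)) = 0) := by
  refine ⟨fun x y z => ?_, fun x y => ?_⟩
  · induction x with
    | zero => simp
    | add x₁ x₂ h₁ h₂ => simp [h₁, h₂]
    | tmul a b =>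
      induction y with
      | zero => simp
      | add y₁ y₂ h₁ h₂ => simp [h₁, h₂]
      | tmul a' b' =>
        induction z with
        | zero => simp
        | add z₁ z₂ h₁ h₂ => simp only [map_add, h₁, h₂]
        | tmul a'' b'' =>
          simp only [hmul, map_add, map_smul, LinearMap.add_apply, LinearMap.smul_apply,
            hηA, hηB, mul_assoc, zero_smul, zero_add, add_zero]
          module
  · induction x with
    | zero => simp
    | add x₁ x₂ h₁ h₂ => simp only [map_add, LinearMap.add_apply, h₁, h₂, add_zero]
    | tmul a b =>
      induction y with
      | zero => simp
      | add y₁ y₂ h₁ h₂ => simp only [map_add, h₁, h₂, add_zero]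
      | tmul a' b' => simp [hmul, hηA, hηB]
end

section
/- Let A be a (possibly non-unital) associative k-algebra, r = Σᵢ uᵢ ⊗ vᵢ ∈ A ⊗ A a solution of the associative Yang–Baxter equation, and Δ(a) = Σᵢ uᵢ ⊗ vᵢ·a − Σᵢ a·uᵢ ⊗ vᵢ the principal comultiplication. If this comultiplication admits a counit η : A → k (i.e. (id ⊗ η)Δ = id = (η ⊗ id)Δ), then A = 0, i.e. every element of A is zero. -/
open TensorProduct

/-- A quasitriangular ε-bialgebra whose principal comultiplication admits a counit
is zero. -/
theorem counital_quasitriangular_is_zero {k A ι : Type*} [CommRing k]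
    [NonUnitalRing A] [Module k A] [SMulCommClass k A A] [IsScalarTower k A A]
    [Fintype ι] (u v : ι → A)
    (hAYBE : (∑ i, ∑ j, (u i * u j) ⊗ₜ[k] ((v j) ⊗ₜ[k] (v i)))
        - (∑ i, ∑ j, (u i) ⊗ₜ[k] ((v i * u j) ⊗ₜ[k] (v j)))
        + (∑ i, ∑ j, (u j) ⊗ₜ[k] ((u i) ⊗ₜ[k] (v i * v j)))
        = (0 : A ⊗[k] (A ⊗[k] A)))
    (Δ : A →ₗ[k] A ⊗[k] A)
    (hΔ : ∀ a : A,
      Δ a = (∑ i, (u i) ⊗ₜ[k] (v i * a)) - ∑ i, (a * u i) ⊗ₜ[k] (v i))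
    (η : A →ₗ[k] k)
    (hcounit₁ : ∀ a : A,
      (TensorProduct.rid k A) ((TensorProduct.map LinearMap.id η) (Δ a)) = a)
    (hcounit₂ : ∀ a : A,
      (TensorProduct.lid k A) ((TensorProduct.map η LinearMap.id) (Δ a)) = a) :
    ∀ a : A, a = 0 := by
  let E : A := ∑ i, η (v i) • u i
  let F : A := ∑ i, η (u i) • v i
  let T : A → A := fun a => ∑ i, η (v i * a) • u i
  let S : A → A := fun a => ∑ i, η (a * u i) • v i
  have right_counit (a : A) : T a - a * E = a := by
    simpa [hΔ, T, E, Finset.mul_sum, mul_smul_comm] using hcounit₁ a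
  have left_counit (a : A) : F * a - S a = a := by
    simpa [hΔ, S, F, Finset.sum_mul, smul_mul_assoc] using hcounit₂ a
  have T_mul (a b : A) : T (a * b) = a * T b := by
    have h := congrArg (a * ·) (right_counit b)
    simp only [mul_sub, ← mul_assoc] at h
    exact sub_left_injective ((right_counit (a * b)).trans h.symm)
  have S_mul (a b : A) : S (a * b) = S a * b := by
    have h := congrArg (· * b) (left_counit a)
    simp only [sub_mul, mul_assoc] at h
    exact sub_right_injective ((left_counit (a * b)).trans h.symm)
  have η_T (a : A) : η (T a) = η (F * a) := by
    simp [T, F, Finset.sum_mul, smul_mul_assoc, mul_comm]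
  have η_S (a : A) : η (S a) = η (a * E) := by
    simp [S, E, Finset.mul_sum, mul_smul_comm, mul_comm]
  have η_mul_T (a b : A) : η (a * T b) = η (S a * b) := by
    simp [S, T, Finset.mul_sum, Finset.sum_mul, mul_smul_comm, smul_mul_assoc, mul_comm]
  have η_mul (a b : A) : η (a * b) = 0 := by
    rw [← right_counit (a * b), map_sub, ← η_S, S_mul, ← η_mul_T, T_mul, sub_self]
  have mul_E (a : A) : a * E = -a := by
    have h := right_counit a
    simp only [T, η_mul, zero_smul, Finset.sum_const_zero, zero_sub] at h
    exact neg_eq_iff_eq_neg.mp h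
  have F_mul (a : A) : F * a = a := by
    simpa [S, η_mul] using left_counit a
  have F_eq : F = -E := by
    rw [← F_mul E, mul_E, neg_neg]
  have mul_F (a : A) : a * F = a := by
    rw [F_eq, mul_neg, mul_E, neg_neg]
  have F_zero : F = 0 := by
    rw [← hcounit₁ F, hΔ]
    simp only [mul_F, F_mul, sub_self, map_zero]
  intro a
  rw [← F_mul a, F_zero, zero_mul]
end
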